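/- Let $\varphi_\Lambda(z) = |\Lambda/2\pi|^{1/2}\exp(-z'\Lambda z/2)$ be the Gaussian kernel with positive definite precision $\Lambda$, let $x_1, x_2 \in \mathbb{R}^d$, $\Delta = x_2 - x_1$, $S = \sqrt{\Delta'\Lambda\Delta} > 0$, and $y_1, y_2 > 0$. Then $\int_{\mathbb{R}^d} \min\Big(\frac{\varphi_\Lambda(z)}{y_1},\, \frac{\varphi_\Lambda(z - \Delta)}{y_2}\Big)\, dz = \frac{1}{y_1}\Phi\Big(\frac{\log(y_1/y_2)}{S} - \frac{S}{2}\Big) + \frac{1}{y_2}\Phi\Big(\frac{\log(y_2/y_1)}{S} - \frac{S}{2}\Big)$, where $\Phi$ is the standard normal CDF. -/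

import Mathlib

open MeasureTheory Real Matrix

noncomputable def gaussKer {d : ℕ} (Λ : Matrix (Fin d) (Fin d) ℝ) (z : Fin d → ℝ) : ℝ :=
  (2 * Real.pi) ^ (-(d : ℝ) / 2) * Real.sqrt Λ.det * Real.exp (-(z ⬝ᵥ Λ.mulVec z) / 2)

/-- The standard normal cumulative distribution function. -/
noncomputable def stdNormalCDF (x : ℝ) : ℝ :=
  ∫ u in Set.Iic x, (Real.sqrt (2 * Real.pi))⁻¹ * Real.exp (-u ^ 2 / 2)

open ProbabilityTheory

lemma pi_gauss_eq (d : ℕ) : Measure.pi (fun _ : Fin d => gaussianReal 0 1) =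
    (volume : Measure (Fin d → ℝ)).withDensity
      (fun x => ENNReal.ofReal (∏ i, gaussianPDFReal 0 1 (x i))) := by
  apply Measure.pi_eq
  intro s hs
  have hbox : MeasurableSet (Set.univ.pi s) := MeasurableSet.univ_pi hs
  have hint : ∀ i, Integrable ((s i).indicator (gaussianPDFReal 0 1)) :=
    fun i => (integrable_gaussianPDFReal 0 1).indicator (hs i)
  rw [withDensity_apply _ hbox, ← lintegral_indicator hbox]
  have h1 : ∀ x : Fin d → ℝ, (Set.univ.pi s).indicator
      (fun x => ENNReal.ofReal (∏ i, gaussianPDFReal 0 1 (x i))) x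
      = ENNReal.ofReal (∏ i, (s i).indicator (gaussianPDFReal 0 1) (x i)) := by
    intro x
    by_cases hx : x ∈ Set.univ.pi s
    · rw [Set.indicator_of_mem hx]
      congr 1
      refine Finset.prod_congr rfl fun i _ => ?_
      rw [Set.indicator_of_mem (hx i trivial)]
    · rw [Set.indicator_of_notMem hx]
      simp only [Set.mem_pi, Set.mem_univ, true_imp_iff, not_forall] at hx
      obtain ⟨i, hi⟩ := hx
      rw [Finset.prod_eq_zero (Finset.mem_univ i) (Set.indicator_of_notMem hi _)]
      simp
  have hnn : ∀ i x, 0 ≤ (s i).indicator (gaussianPDFReal 0 1) x :=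
    fun i x => Set.indicator_nonneg (fun y _ => gaussianPDFReal_nonneg 0 1 y) x
  simp_rw [h1]
  rw [← ofReal_integral_eq_lintegral_ofReal]
  · rw [integral_fintype_prod_volume_eq_prod
      (f := fun i => (s i).indicator (gaussianPDFReal 0 1)),
      ENNReal.ofReal_prod_of_nonneg (fun i _ => integral_nonneg (hnn i))]
    refine Finset.prod_congr rfl fun i _ => ?_
    rw [integral_indicator (hs i), gaussianReal_apply_eq_integral _ one_ne_zero]
  · exact Integrable.fintype_prod hint
  · exact ae_of_all _ fun x => Finset.prod_nonneg fun i _ => hnn i _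

lemma prod_pdf (d : ℕ) (x : Fin d → ℝ) : ∏ i, gaussianPDFReal 0 1 (x i) =
    (2 * Real.pi) ^ (-(d : ℝ) / 2) * Real.exp (-(x ⬝ᵥ x) / 2) := by
  have h2 : (√(2 * π))⁻¹ ^ d = (2 * Real.pi) ^ (-(d : ℝ) / 2) := by
    rw [Real.sqrt_eq_rpow, ← Real.rpow_neg (by positivity), ← Real.rpow_natCast,
      ← Real.rpow_mul (by positivity)]
    congr 1; ring
  simp only [gaussianPDFReal, NNReal.coe_one, mul_one, sub_zero, Finset.prod_mul_distrib,
    Finset.prod_const, Finset.card_univ, Fintype.card_fin, ← Real.exp_sum, h2]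
  congr 2
  rw [← Finset.sum_div, Finset.sum_neg_distrib]
  simp [dotProduct, sq]

lemma integral_pi_gauss (d : ℕ) (f : (Fin d → ℝ) → ℝ) :
    ∫ x, f x ∂(Measure.pi (fun _ : Fin d => gaussianReal 0 1)) =
    ∫ x, (2 * Real.pi) ^ (-(d : ℝ) / 2) * Real.exp (-(x ⬝ᵥ x) / 2) * f x := by
  rw [pi_gauss_eq, integral_withDensity_eq_integral_toReal_smul]
  · refine integral_congr_ae (ae_of_all _ fun x => ?_)
    simp only [smul_eq_mul]
    rw [ENNReal.toReal_ofReal (Finset.prod_nonneg fun i _ => gaussianPDFReal_nonneg _ _ _),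
      prod_pdf]
  · have := measurable_gaussianPDFReal 0 1
    fun_prop
  · exact ae_of_all _ fun x => ENNReal.ofReal_lt_top

lemma map_dot_gauss (d : ℕ) (v : Fin d → ℝ) (hv : v ⬝ᵥ v = 1) :
    (Measure.pi (fun _ : Fin d => gaussianReal 0 1)).map (fun x => v ⬝ᵥ x)
      = gaussianReal 0 1 := by
  have h := IsGaussian.map_eq_gaussianReal (μ := stdGaussian (EuclideanSpace ℝ (Fin d)))
    (innerSL ℝ (WithLp.toLp 2 v))
  have hn : ‖(WithLp.toLp 2 v : EuclideanSpace ℝ (Fin d))‖ ^ 2 = 1 := by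
    rw [EuclideanSpace.real_norm_sq_eq, ← hv]
    simp [dotProduct, sq]
  rw [variance_dual_stdGaussian, integral_strongDual_stdGaussian, innerSL_apply_norm, hn,
    Real.toNNReal_one, ← map_pi_eq_stdGaussian, Measure.map_map (by fun_prop) (by fun_prop)] at h
  refine Eq.trans ?_ h
  congr 1
  ext x
  simp [EuclideanSpace.inner_eq_star_dotProduct, dotProduct_comm]

lemma oneD (S a b : ℝ) (hS : 0 < S) (ha : 0 < a) (hb : 0 < b) :
    ∫ t, gaussianPDFReal 0 1 t * min (1 / a) (Real.exp (S * t - S ^ 2 / 2) / b) =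
      (1 / a) * stdNormalCDF (Real.log (a / b) / S - S / 2)
        + (1 / b) * stdNormalCDF (Real.log (b / a) / S - S / 2) := by
  have hpdf : ∀ t, gaussianPDFReal 0 1 t = (√(2 * π))⁻¹ * Real.exp (-t ^ 2 / 2) := by
    intro t; simp [gaussianPDFReal]
  have hcdf : ∀ x, stdNormalCDF x = ∫ u in Set.Iic x, gaussianPDFReal 0 1 u := by
    intro x; simp only [hpdf, stdNormalCDF]
  set t0 : ℝ := S / 2 + Real.log (b / a) / S with ht0
  have hlog : Real.log (a / b) = - Real.log (b / a) := by
    rw [← Real.log_inv, inv_div]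
  have hcond : ∀ t, Real.exp (S * t - S ^ 2 / 2) / b ≤ 1 / a ↔ t ≤ t0 := by
    intro t
    rw [div_le_iff₀ hb, one_div_mul_eq_div, ← Real.le_log_iff_exp_le (by positivity), ht0]
    rw [← mul_le_mul_iff_right₀ (b := t) hS]
    have : S * (S / 2 + Real.log (b / a) / S) = S ^ 2 / 2 + Real.log (b / a) := by
      field_simp
    rw [this]; constructor <;> intro h <;> linarith
  have hshift : ∀ t, gaussianPDFReal 0 1 t * (Real.exp (S * t - S ^ 2 / 2) / b)
      = (1 / b) * gaussianPDFReal 0 1 (t - S) := by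
    intro t
    have : Real.exp (-(t - S) ^ 2 / 2) = Real.exp (-t ^ 2 / 2) * Real.exp (S * t - S ^ 2 / 2) := by
      rw [← Real.exp_add]; congr 1; ring
    rw [hpdf, hpdf, this]; ring
  have hi := integrable_gaussianPDFReal 0 1
  have hi2 : Integrable fun t => gaussianPDFReal 0 1 (t - S) := hi.comp_sub_right S
  have e1 : ∀ t ∈ Set.Iic t0,
      gaussianPDFReal 0 1 t * min (1 / a) (Real.exp (S * t - S ^ 2 / 2) / b)
      = (1 / b) * gaussianPDFReal 0 1 (t - S) := by
    intro t ht
    rw [min_eq_right ((hcond t).2 ht), hshift]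
  have e2 : ∀ t ∈ (Set.Iic t0)ᶜ,
      gaussianPDFReal 0 1 t * min (1 / a) (Real.exp (S * t - S ^ 2 / 2) / b)
      = (1 / a) * gaussianPDFReal 0 1 t := by
    intro t ht
    rw [min_eq_left, mul_comm]
    by_contra hc
    exact ht ((hcond t).1 (le_of_not_ge hc))
  have hint : Integrable fun t =>
      gaussianPDFReal 0 1 t * min (1 / a) (Real.exp (S * t - S ^ 2 / 2) / b) := by
    refine (hi.const_mul (1 / a)).mono' ?_ (ae_of_all _ fun t => ?_)
    · have := measurable_gaussianPDFReal 0 1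
      exact Measurable.aestronglyMeasurable (by fun_prop)
    · have h0 := gaussianPDFReal_nonneg 0 1 t
      rw [Real.norm_of_nonneg (mul_nonneg h0 (le_min (by positivity) (by positivity))), mul_comm]
      exact mul_le_mul_of_nonneg_right (min_le_left _ _) h0
  rw [← integral_add_compl (measurableSet_Iic (a := t0)) hint,
    setIntegral_congr_fun measurableSet_Iic e1,
    setIntegral_congr_fun measurableSet_Iic.compl e2, integral_const_mul, integral_const_mul,
    add_comm, hcdf, hcdf]
  congr 2
  · rw [Set.compl_Iic]
    have : Real.log (a / b) / S - S / 2 = -t0 := by rw [ht0, hlog]; ring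
    rw [this]
    have h := integral_comp_neg_Ioi t0 (gaussianPDFReal 0 1)
    rw [← h]
    refine integral_congr_ae (ae_of_all _ fun t => ?_)
    simp [hpdf]
  · have h := (measurePreserving_sub_right volume S).setIntegral_preimage_emb
      (MeasurableEquiv.subRight S).measurableEmbedding (gaussianPDFReal 0 1) (Set.Iic (t0 - S))
    have : Real.log (b / a) / S - S / 2 = t0 - S := by rw [ht0]; ring
    rw [this, ← h]
    simp

theorem stmt9 {d : ℕ} (Λ : Matrix (Fin d) (Fin d) ℝ) (hΛ : Λ.PosDef)
    (x₁ x₂ : Fin d → ℝ) (hx : x₁ ≠ x₂)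
    (y₁ y₂ : ℝ) (hy₁ : 0 < y₁) (hy₂ : 0 < y₂)
    (S : ℝ) (hS : S = Real.sqrt ((x₂ - x₁) ⬝ᵥ Λ.mulVec (x₂ - x₁))) :
    ∫ z : Fin d → ℝ, min (gaussKer Λ z / y₁) (gaussKer Λ (z - (x₂ - x₁)) / y₂) =
      (1 / y₁) * stdNormalCDF (Real.log (y₁ / y₂) / S - S / 2)
        + (1 / y₂) * stdNormalCDF (Real.log (y₂ / y₁) / S - S / 2) := by
  have hΔ : x₂ - x₁ ≠ 0 := sub_ne_zero.2 hx.symm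
  generalize x₂ - x₁ = Δ at *
  obtain ⟨B, hB⟩ : ∃ B : Matrix (Fin d) (Fin d) ℝ, Λ = Bᵀ * B := by
    open scoped MatrixOrder in
    obtain ⟨B, hB⟩ := CStarAlgebra.nonneg_iff_eq_star_mul_self.mp hΛ.posSemidef.nonneg
    exact ⟨B, by rw [hB, Matrix.star_eq_conjTranspose, Matrix.conjTranspose_eq_transpose_of_trivial]⟩
  have hq : ∀ z w : Fin d → ℝ, z ⬝ᵥ Λ.mulVec w = (B.mulVec z) ⬝ᵥ (B.mulVec w) := by
    intro z w
    rw [hB, ← Matrix.mulVec_mulVec, Matrix.dotProduct_mulVec, Matrix.vecMul_transpose]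
  have hdet : Λ.det = B.det ^ 2 := by rw [hB, Matrix.det_mul, Matrix.det_transpose, sq]
  have hdpos := hΛ.det_pos
  have hB0 : B.det ≠ 0 := by
    intro h; rw [hdet, h] at hdpos; simp at hdpos
  have hsq : Real.sqrt Λ.det = |B.det| := by rw [hdet, Real.sqrt_sq_eq_abs]
  have hpos : 0 < Δ ⬝ᵥ Λ.mulVec Δ := by simpa using hΛ.dotProduct_mulVec_pos hΔ
  have hS0 : 0 < S := by rw [hS]; exact Real.sqrt_pos.2 hpos
  have hS2 : (B.mulVec Δ) ⬝ᵥ (B.mulVec Δ) = S ^ 2 := by rw [hS, Real.sq_sqrt hpos.le, hq]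
  set v : Fin d → ℝ := S⁻¹ • B.mulVec Δ with hv
  have hvv : v ⬝ᵥ v = 1 := by
    rw [hv, smul_dotProduct, dotProduct_smul, hS2]; simp only [smul_eq_mul]; field_simp
  set c : ℝ := (2 * Real.pi) ^ (-(d : ℝ) / 2) with hc
  have hc0 : 0 < c := by positivity
  let g : ℝ → ℝ := fun t => min (1 / y₁) (Real.exp (S * t - S ^ 2 / 2) / y₂)
  have hgc : Measurable g := by fun_prop
  let F : (Fin d → ℝ) → ℝ := fun w => c * Real.exp (-(w ⬝ᵥ w) / 2) * g (v ⬝ᵥ w)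
  have key : ∀ z, min (gaussKer Λ z / y₁) (gaussKer Λ (z - Δ) / y₂)
      = |B.det| * F (Matrix.toLin' B z) := by
    intro z
    simp only [gaussKer, hsq, hq, F, g, Matrix.toLin'_apply, ← hc]
    have e : Real.exp (-(B.mulVec (z - Δ) ⬝ᵥ B.mulVec (z - Δ)) / 2) =
        Real.exp (-(B.mulVec z ⬝ᵥ B.mulVec z) / 2) *
          Real.exp (S * (v ⬝ᵥ B.mulVec z) - S ^ 2 / 2) := by
      rw [← Real.exp_add, ← hS2, hv, smul_dotProduct, smul_eq_mul, mul_inv_cancel_left₀ hS0.ne',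
        Matrix.mulVec_sub, sub_dotProduct, dotProduct_sub, dotProduct_sub,
        dotProduct_comm (B.mulVec z) (B.mulVec Δ)]
      congr 1; ring
    rw [e, mul_min_of_nonneg _ _ (by positivity), mul_min_of_nonneg _ _ (by positivity)]
    congr 1 <;> ring
  simp_rw [key]
  have hFm : AEStronglyMeasurable F (Measure.map (Matrix.toLin' B) volume) := by
    apply Measurable.aestronglyMeasurable
    have h1 : Measurable fun w : Fin d → ℝ => w ⬝ᵥ w := by unfold dotProduct; fun_prop
    have h2 : Measurable fun w : Fin d → ℝ => v ⬝ᵥ w := by unfold dotProduct; fun_prop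
    exact (measurable_const.mul (by fun_prop)).mul (hgc.comp h2)
  have hlin : Measurable (Matrix.toLin' B) :=
    (LinearMap.continuous_of_finiteDimensional _).measurable
  rw [integral_const_mul, ← integral_map hlin.aemeasurable hFm,
    Real.map_matrix_volume_pi_eq_smul_volume_pi hB0, integral_smul_measure,
    ENNReal.toReal_ofReal (abs_nonneg _), smul_eq_mul, ← mul_assoc, ← abs_mul,
    mul_inv_cancel₀ hB0, abs_one, one_mul, ← integral_pi_gauss d (fun w => g (v ⬝ᵥ w))]
  have hdm : Measurable fun w : Fin d → ℝ => v ⬝ᵥ w := by unfold dotProduct; fun_prop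
  rw [← integral_map (φ := fun w : Fin d → ℝ => v ⬝ᵥ w) (f := g) hdm.aemeasurable
    hgc.aestronglyMeasurable, map_dot_gauss d v hvv,
    integral_gaussianReal_eq_integral_smul one_ne_zero]
  exact oneD S y₁ y₂ hS0 hy₁ hy₂
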